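/- arXiv:1705.00947 — 3 statements merged into one kernel-verified Lean document; each statement's English description precedes it below -/
import Mathlib

section
/- In the BWA rating setup with penalty parameter λ ∈ [0, 1), the reputation update is λ-Lipschitz with respect to the sup norm on rankings: for all ranking vectors r, r' : Fin M → ℝ and every user i, |c_i(r) − c_i(r')| ≤ λ · max_{j} |r_j − r'_j|. -/
open Finset

/-- BWA reputation update: the reputation of user `i` given rankings `r` is one minus
`λ` times the average disagreement of user `i`'s ratings with the rankings. -/
noncomputable def bwaRep {N M : ℕ} (R : Fin N → Fin M → ℝ) (lam : ℝ) (r : Fin M → ℝ)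
    (i : Fin N) : ℝ :=
  1 - (lam / M) * ∑ j, |R i j - r j|

/-- In the BWA rating setup with penalty `λ ∈ [0,1)`, the reputation update is `λ`-Lipschitz
with respect to the sup norm on rankings:
`|c_i(r) - c_i(r')| ≤ λ * max_j |r_j - r'_j|` for every user `i`. -/
theorem bwaRep_lipschitz {N M : ℕ} (hN : 1 ≤ N) (hM : 1 ≤ M)
    (Rbot Rtop : ℝ) (hbot : 0 < Rbot) (hbt : Rbot ≤ Rtop) (htop : Rtop ≤ 1)
    (R : Fin N → Fin M → ℝ) (hR : ∀ (i : Fin N) (j : Fin M), Rbot ≤ R i j ∧ R i j ≤ Rtop)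
    (lam : ℝ) (hlam0 : 0 ≤ lam) (hlam1 : lam < 1)
    (r r' : Fin M → ℝ) :
    ∀ i : Fin N, |bwaRep R lam r i - bwaRep R lam r' i| ≤
      lam * Finset.univ.sup' (Finset.univ_nonempty_iff.mpr ⟨⟨0, hM⟩⟩)
        (fun j : Fin M => |r j - r' j|) := by
  intro i
  set S := Finset.univ.sup' (Finset.univ_nonempty_iff.mpr ⟨⟨0, hM⟩⟩)
        (fun j : Fin M => |r j - r' j|) with hS
  have hMpos : (0 : ℝ) < M := by exact_mod_cast hM
  have hj : ∀ j : Fin M, |r j - r' j| ≤ S := fun j =>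
    Finset.le_sup' (fun j : Fin M => |r j - r' j|) (Finset.mem_univ j)
  have hsum : |∑ j, (|R i j - r' j| - |R i j - r j|)| ≤ M * S := by
    calc |∑ j, (|R i j - r' j| - |R i j - r j|)|
        ≤ ∑ j, |(|R i j - r' j| - |R i j - r j|)| := Finset.abs_sum_le_sum_abs _ _
      _ ≤ ∑ _j : Fin M, S := by
          refine Finset.sum_le_sum fun j _ => ?_
          refine (abs_abs_sub_abs_le_abs_sub _ _).trans ?_
          have h : R i j - r' j - (R i j - r j) = r j - r' j := by ring
          rw [h]
          exact hj j
      _ = M * S := by simp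
  have heq : bwaRep R lam r i - bwaRep R lam r' i
      = (lam / M) * ∑ j, (|R i j - r' j| - |R i j - r j|) := by
    rw [Finset.sum_sub_distrib]
    unfold bwaRep
    ring
  have hc : 0 ≤ lam / (M : ℝ) := div_nonneg hlam0 hMpos.le
  rw [heq, abs_mul, abs_of_nonneg hc]
  calc lam / M * |∑ j, (|R i j - r' j| - |R i j - r j|)|
      ≤ lam / M * (M * S) := mul_le_mul_of_nonneg_left hsum hc
    _ = lam * S := by field_simp
end

section
/- In the BWA rating setup with penalty parameter λ ∈ [0, 1), assume Δ > 0, and consider the composite BWA map T on ranking vectors, T(r)_j = r_j(c(r)) = (Σ_i R_{ij} · c_i(r)) / (Σ_i c_i(r)). Then for all ranking vectors r, r' : Fin M → ℝ with entries in [R_⊥, R_⊤] and every item j, |T(r)_j − T(r')_j| ≤ (λ·Δ / (1 − λ·Δ)) · max_{j'} |r_{j'} − r'_{j'}|; that is, successive ranking iterates satisfy ‖r^{k+1} − r^k‖_∞ ≤ (λ·Δ / (1 − λ·Δ)) · ‖r^k − r^{k−1}‖_∞. -/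
open Finset

/-- Composite BWA map on ranking vectors: first update reputations from the rankings,
then recompute the rankings as reputation-weighted averages. -/
noncomputable def bwaT {N M : ℕ} (R : Fin N → Fin M → ℝ) (lam : ℝ) (r : Fin M → ℝ)
    (j : Fin M) : ℝ :=
  (∑ i, R i j * bwaRep R lam r i) / (∑ i, bwaRep R lam r i)

/-- In the BWA rating setup with `λ ∈ [0,1)` and `Δ = R⊤ - R⊥ > 0`, the composite BWA map
is `(λΔ/(1-λΔ))`-Lipschitz in sup norm on ranking vectors with entries in `[R⊥, R⊤]`:
successive iterates satisfy `‖r^{k+1} - r^k‖_∞ ≤ (λΔ/(1-λΔ)) ‖r^k - r^{k-1}‖_∞`. -/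
theorem bwaT_contraction_bound {N M : ℕ} (hN : 1 ≤ N) (hM : 1 ≤ M)
    (Rbot Rtop : ℝ) (hbot : 0 < Rbot) (hbt : Rbot ≤ Rtop) (htop : Rtop ≤ 1)
    (hΔ : 0 < Rtop - Rbot)
    (R : Fin N → Fin M → ℝ) (hR : ∀ (i : Fin N) (j : Fin M), Rbot ≤ R i j ∧ R i j ≤ Rtop)
    (lam : ℝ) (hlam0 : 0 ≤ lam) (hlam1 : lam < 1)
    (r r' : Fin M → ℝ) (hr : ∀ j : Fin M, Rbot ≤ r j ∧ r j ≤ Rtop)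
    (hr' : ∀ j : Fin M, Rbot ≤ r' j ∧ r' j ≤ Rtop) :
    ∀ j : Fin M, |bwaT R lam r j - bwaT R lam r' j| ≤
      (lam * (Rtop - Rbot) / (1 - lam * (Rtop - Rbot))) *
        Finset.univ.sup' (Finset.univ_nonempty_iff.mpr ⟨⟨0, hM⟩⟩)
          (fun j' : Fin M => |r j' - r' j'|) := by
  intro j
  set D := Finset.univ.sup' (Finset.univ_nonempty_iff.mpr ⟨⟨0, hM⟩⟩)
          (fun j' : Fin M => |r j' - r' j'|) with hD
  have hDj : ∀ k, |r k - r' k| ≤ D := fun k =>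
    Finset.le_sup' (fun j' : Fin M => |r j' - r' j'|) (Finset.mem_univ k)
  have hD0 : 0 ≤ D := (abs_nonneg _).trans (hDj j)
  have hMpos : (0 : ℝ) < M := by exact_mod_cast hM
  have hNpos : (0 : ℝ) < N := by exact_mod_cast hN
  have hq : 0 < 1 - lam * (Rtop - Rbot) := by nlinarith
  have hmean : ∀ (f : Fin M → ℝ) (B : ℝ), (∀ k, f k ≤ B) → (lam / M) * ∑ k, f k ≤ lam * B := by
    intro f B hf
    have h1 : ∑ k, f k ≤ M * B := by
      have := Finset.sum_le_sum (fun k (_ : k ∈ Finset.univ) => hf k)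
      simpa using this
    calc (lam / M) * ∑ k, f k ≤ (lam / M) * (M * B) := by gcongr
      _ = lam * B := by field_simp
  have hlow : ∀ s : Fin M → ℝ, (∀ k, Rbot ≤ s k ∧ s k ≤ Rtop) → ∀ i,
      1 - lam * (Rtop - Rbot) ≤ bwaRep R lam s i := by
    intro s hs i
    have := hmean (fun k => |R i k - s k|) (Rtop - Rbot) (fun k => by
      have h1 := hs k
      have h2 := hR i k
      rw [abs_le]; constructor <;> linarith)
    unfold bwaRep
    linarith
  have hdiff : ∀ i, |bwaRep R lam r i - bwaRep R lam r' i| ≤ lam * D := by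
    intro i
    have e : bwaRep R lam r i - bwaRep R lam r' i
        = (lam / M) * ∑ k, (|R i k - r' k| - |R i k - r k|) := by
      unfold bwaRep
      rw [Finset.sum_sub_distrib]; ring
    rw [e, abs_mul, abs_of_nonneg (by positivity : 0 ≤ lam / M)]
    calc (lam / M) * |∑ k, (|R i k - r' k| - |R i k - r k|)|
        ≤ (lam / M) * ∑ k, |(|R i k - r' k| - |R i k - r k|)| := by
          gcongr; exact Finset.abs_sum_le_sum_abs _ _
      _ ≤ lam * D := hmean _ _ (fun k => by
          refine (abs_abs_sub_abs_le_abs_sub _ _).trans ?_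
          have : R i k - r' k - (R i k - r k) = r k - r' k := by ring
          rw [this]; exact hDj k)
  have hsum : ∀ s : Fin M → ℝ, (∀ k, Rbot ≤ s k ∧ s k ≤ Rtop) →
      N * (1 - lam * (Rtop - Rbot)) ≤ ∑ i, bwaRep R lam s i := by
    intro s hs
    have := Finset.sum_le_sum (fun i (_ : i ∈ Finset.univ) => hlow s hs i)
    rw [Finset.sum_const, Finset.card_univ, Fintype.card_fin, nsmul_eq_mul] at this
    exact this
  have hNq : 0 < N * (1 - lam * (Rtop - Rbot)) := by positivity
  have hC := hsum r hr
  have hC0 := hNq.trans_le hC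
  have hC0' := hNq.trans_le (hsum r' hr')
  have hT1 : bwaT R lam r' j ≤ Rtop := by
    unfold bwaT
    rw [div_le_iff₀ hC0', Finset.mul_sum]
    exact Finset.sum_le_sum fun i _ =>
      mul_le_mul_of_nonneg_right (hR i j).2 (hq.le.trans (hlow r' hr' i))
  have hT2 : Rbot ≤ bwaT R lam r' j := by
    unfold bwaT
    rw [le_div_iff₀ hC0', Finset.mul_sum]
    exact Finset.sum_le_sum fun i _ =>
      mul_le_mul_of_nonneg_right (hR i j).1 (hq.le.trans (hlow r' hr' i))
  have hT : bwaT R lam r' j * ∑ i, bwaRep R lam r' i = ∑ i, R i j * bwaRep R lam r' i :=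
    div_mul_cancel₀ _ hC0'.ne'
  have key : bwaT R lam r j - bwaT R lam r' j =
      (∑ i, (R i j - bwaT R lam r' j) * (bwaRep R lam r i - bwaRep R lam r' i)) /
        ∑ i, bwaRep R lam r i := by
    rw [eq_div_iff hC0.ne', sub_mul]
    have h1 : bwaT R lam r j * ∑ i, bwaRep R lam r i = ∑ i, R i j * bwaRep R lam r i :=
      div_mul_cancel₀ _ hC0.ne'
    simp only [sub_mul, mul_sub, Finset.sum_sub_distrib, ← Finset.mul_sum]
    rw [h1, hT]; ring
  have hnum : |∑ i, (R i j - bwaT R lam r' j) * (bwaRep R lam r i - bwaRep R lam r' i)| ≤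
      N * ((Rtop - Rbot) * (lam * D)) := by
    refine (Finset.abs_sum_le_sum_abs _ _).trans ?_
    have := Finset.sum_le_sum (s := (Finset.univ : Finset (Fin N)))
      (f := fun i => |(R i j - bwaT R lam r' j) * (bwaRep R lam r i - bwaRep R lam r' i)|)
      (g := fun _ => (Rtop - Rbot) * (lam * D)) (fun i _ => by
        simp only [abs_mul]
        refine mul_le_mul ?_ (hdiff i) (abs_nonneg _) hΔ.le
        have h2 := hR i j
        rw [abs_le]; constructor <;> linarith)
    simpa using this
  rw [key, abs_div, abs_of_pos hC0]
  calc _ ≤ N * ((Rtop - Rbot) * (lam * D)) / (N * (1 - lam * (Rtop - Rbot))) := by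
        gcongr
    _ = _ := by field_simp
end

section
/- In the BWA rating setup, for every λ ∈ [0, 1/(1 + Δ)), the BWA iteration converges: starting from any initial reputation vector c⁰ : Fin N → ℝ with 0 < c⁰_i ≤ 1 for all i, and iterating r^{k+1} = r(c^k) (ranking update) followed by c^{k+1} = c(r^{k+1}) (reputation update), there exists a ranking vector r* : Fin M → ℝ such that r^k → r* as k → ∞ (in sup norm). -/
open Finset Filter Topology

/-- BWA ranking update. -/
noncomputable def bwaRank {N M : ℕ} (R : Fin N → Fin M → ℝ) (c : Fin N → ℝ) (j : Fin M) : ℝ :=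
  (∑ i, R i j * c i) / (∑ i, c i)

lemma bwa_rank_bounds {N M : ℕ} (hN : 1 ≤ N) (Rbot Rtop : ℝ)
    (R : Fin N → Fin M → ℝ) (hR : ∀ (i : Fin N) (j : Fin M), Rbot ≤ R i j ∧ R i j ≤ Rtop)
    (c : Fin N → ℝ) (hc : ∀ i, 0 < c i) (j : Fin M) :
    Rbot ≤ bwaRank R c j ∧ bwaRank R c j ≤ Rtop := by
  have hS : 0 < ∑ i, c i :=
    Finset.sum_pos (fun i _ => hc i) ⟨⟨0, hN⟩, Finset.mem_univ _⟩
  unfold bwaRank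
  rw [le_div_iff₀ hS, div_le_iff₀ hS, Finset.mul_sum, Finset.mul_sum]
  exact ⟨Finset.sum_le_sum fun i _ => mul_le_mul_of_nonneg_right (hR i j).1 (hc i).le,
    Finset.sum_le_sum fun i _ => mul_le_mul_of_nonneg_right (hR i j).2 (hc i).le⟩

lemma bwa_rep_lower {N M : ℕ} (hM : 1 ≤ M) (Rbot Rtop : ℝ)
    (R : Fin N → Fin M → ℝ) (hR : ∀ (i : Fin N) (j : Fin M), Rbot ≤ R i j ∧ R i j ≤ Rtop)
    (lam : ℝ) (hlam0 : 0 ≤ lam) (r : Fin M → ℝ) (hr : ∀ j, Rbot ≤ r j ∧ r j ≤ Rtop)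
    (i : Fin N) : 1 - lam * (Rtop - Rbot) ≤ bwaRep R lam r i := by
  have hM' : (0 : ℝ) < M := by exact_mod_cast hM
  have h : ∑ j, |R i j - r j| ≤ M * (Rtop - Rbot) := by
    calc ∑ j, |R i j - r j| ≤ ∑ _j : Fin M, (Rtop - Rbot) :=
          Finset.sum_le_sum fun j _ => abs_le.2
            ⟨by linarith [(hR i j).1, (hr j).2], by linarith [(hR i j).2, (hr j).1]⟩
      _ = M * (Rtop - Rbot) := by
          simp
          ring
  have h2 := mul_le_mul_of_nonneg_left h (div_nonneg hlam0 hM'.le)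
  have h3 : lam / M * (M * (Rtop - Rbot)) = lam * (Rtop - Rbot) := by field_simp
  unfold bwaRep
  linarith

lemma bwa_rep_lip {N M : ℕ} (hM : 1 ≤ M)
    (R : Fin N → Fin M → ℝ) (lam : ℝ) (hlam0 : 0 ≤ lam) (r s : Fin M → ℝ)
    (i : Fin N) : |bwaRep R lam r i - bwaRep R lam s i| ≤ lam * dist r s := by
  have hM' : (0 : ℝ) < M := by exact_mod_cast hM
  have h : |∑ j, (|R i j - s j| - |R i j - r j|)| ≤ M * dist r s := by
    calc |∑ j, (|R i j - s j| - |R i j - r j|)|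
        ≤ ∑ j, |(|R i j - s j| - |R i j - r j|)| := Finset.abs_sum_le_sum_abs _ _
      _ ≤ ∑ _j : Fin M, dist r s := by
          refine Finset.sum_le_sum fun j _ => ?_
          refine (abs_abs_sub_abs_le_abs_sub _ _).trans ?_
          have := dist_le_pi_dist r s j
          rw [Real.dist_eq] at this
          rwa [show R i j - s j - (R i j - r j) = r j - s j by ring]
      _ = M * dist r s := by simp
  have h1 : bwaRep R lam r i - bwaRep R lam s i
      = lam / M * ∑ j, (|R i j - s j| - |R i j - r j|) := by
    unfold bwaRep
    rw [Finset.sum_sub_distrib]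
    ring
  rw [h1, abs_mul, abs_of_nonneg (div_nonneg hlam0 hM'.le)]
  refine (mul_le_mul_of_nonneg_left h (div_nonneg hlam0 hM'.le)).trans (le_of_eq ?_)
  field_simp

lemma bwa_rank_lip {N M : ℕ} (hN : 1 ≤ N) (Rbot Rtop : ℝ) (hbt : Rbot ≤ Rtop)
    (R : Fin N → Fin M → ℝ) (hR : ∀ (i : Fin N) (j : Fin M), Rbot ≤ R i j ∧ R i j ≤ Rtop)
    (c d : Fin N → ℝ) (m e : ℝ) (hm : 0 < m) (he : 0 ≤ e)
    (hc : ∀ i, m ≤ c i) (hd : ∀ i, 0 < d i)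
    (hcd : ∀ i, |c i - d i| ≤ e) :
    dist (bwaRank R c) (bwaRank R d) ≤ (Rtop - Rbot) * e / m := by
  have hN' : (0 : ℝ) < N := by exact_mod_cast hN
  have hD : 0 ≤ Rtop - Rbot := sub_nonneg.2 hbt
  have hS : N * m ≤ ∑ i, c i := by
    calc N * m = ∑ _i : Fin N, m := by simp
      _ ≤ _ := Finset.sum_le_sum fun i _ => hc i
  have hS0 : 0 < ∑ i, c i := lt_of_lt_of_le (by positivity) hS
  have hT0 : 0 < ∑ i, d i :=
    Finset.sum_pos (fun i _ => hd i) ⟨⟨0, hN⟩, Finset.mem_univ _⟩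
  refine (dist_pi_le_iff (by positivity)).2 fun j => ?_
  have hb := bwa_rank_bounds hN Rbot Rtop R hR d hd j
  have hq : bwaRank R d j * ∑ i, d i = ∑ i, R i j * d i := by
    unfold bwaRank
    exact div_mul_cancel₀ _ hT0.ne'
  have hp : bwaRank R c j * ∑ i, c i = ∑ i, R i j * c i := by
    unfold bwaRank
    exact div_mul_cancel₀ _ hS0.ne'
  generalize bwaRank R d j = q at *
  generalize bwaRank R c j = p at *
  have key : (p - q) * ∑ i, c i = ∑ i, (R i j - q) * (c i - d i) := by
    have : ∑ i, (R i j - q) * (c i - d i)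
        = ∑ i, R i j * c i - ∑ i, R i j * d i - (q * ∑ i, c i - q * ∑ i, d i) := by
      rw [Finset.mul_sum, Finset.mul_sum, ← Finset.sum_sub_distrib, ← Finset.sum_sub_distrib,
        ← Finset.sum_sub_distrib]
      exact Finset.sum_congr rfl fun i _ => by ring
    rw [this, ← hp, ← hq]
    ring
  have hbound : |p - q| * ∑ i, c i ≤ N * ((Rtop - Rbot) * e) := by
    rw [← abs_of_pos hS0, ← abs_mul, key]
    calc |∑ i, (R i j - q) * (c i - d i)| ≤ ∑ i, |(R i j - q) * (c i - d i)| :=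
          Finset.abs_sum_le_sum_abs _ _
      _ ≤ ∑ _i : Fin N, (Rtop - Rbot) * e := by
          refine Finset.sum_le_sum fun i _ => ?_
          rw [abs_mul]
          refine mul_le_mul (abs_le.2 ⟨?_, ?_⟩) (hcd i) (abs_nonneg _) hD
          · linarith [(hR i j).1, hb.2]
          · linarith [(hR i j).2, hb.1]
      _ = N * ((Rtop - Rbot) * e) := by simp
  have h2 : |p - q| * (N * m) ≤ N * ((Rtop - Rbot) * e) :=
    (mul_le_mul_of_nonneg_left hS (abs_nonneg _)).trans hbound
  rw [Real.dist_eq, le_div_iff₀ hm]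
  refine le_of_mul_le_mul_left ?_ hN'
  linarith

/-- In the BWA rating setup, for every `λ ∈ [0, 1/(1+Δ))`, the BWA iteration
`r^{k+1} = r(c^k)`, `c^{k+1} = c(r^{k+1})` started from any initial reputation vector with
entries in `(0,1]` converges: the ranking vectors `r^k` tend to some limit `r*`
(in sup norm on `Fin M → ℝ`). -/
theorem bwa_iteration_converges {N M : ℕ} (hN : 1 ≤ N) (hM : 1 ≤ M)
    (Rbot Rtop : ℝ) (hbot : 0 < Rbot) (hbt : Rbot ≤ Rtop) (htop : Rtop ≤ 1)
    (R : Fin N → Fin M → ℝ) (hR : ∀ (i : Fin N) (j : Fin M), Rbot ≤ R i j ∧ R i j ≤ Rtop)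
    (lam : ℝ) (hlam0 : 0 ≤ lam) (hlam1 : lam < 1 / (1 + (Rtop - Rbot)))
    (c : ℕ → Fin N → ℝ) (r : ℕ → Fin M → ℝ)
    (hc0 : ∀ i : Fin N, 0 < c 0 i ∧ c 0 i ≤ 1)
    (hrstep : ∀ k : ℕ, r (k + 1) = bwaRank R (c k))
    (hcstep : ∀ k : ℕ, c (k + 1) = bwaRep R lam (r (k + 1))) :
    ∃ rstar : Fin M → ℝ, Tendsto r atTop (𝓝 rstar) := by
  have hD : 0 ≤ Rtop - Rbot := sub_nonneg.2 hbt
  have hl : lam * (1 + (Rtop - Rbot)) < 1 := (lt_div_iff₀ (by linarith)).1 hlam1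
  have h2 : 2 * (lam * (Rtop - Rbot)) < 1 := by nlinarith
  have hlD : 0 ≤ lam * (Rtop - Rbot) := mul_nonneg hlam0 hD
  have hm : 0 < 1 - lam * (Rtop - Rbot) := by linarith
  have hcpos : ∀ k i, 0 < c k i := by
    intro k
    induction k with
    | zero => exact fun i => (hc0 i).1
    | succ k ih =>
      intro i
      rw [hcstep k]
      refine hm.trans_le (bwa_rep_lower hM Rbot Rtop R hR lam hlam0 _ (fun j => ?_) i)
      rw [hrstep k]
      exact bwa_rank_bounds hN Rbot Rtop R hR _ ih j
  have hclow : ∀ k i, 1 - lam * (Rtop - Rbot) ≤ c (k + 1) i := by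
    intro k i
    rw [hcstep k]
    refine bwa_rep_lower hM Rbot Rtop R hR lam hlam0 _ (fun j => ?_) i
    rw [hrstep k]
    exact bwa_rank_bounds hN Rbot Rtop R hR _ (hcpos k) j
  set q := lam * (Rtop - Rbot) / (1 - lam * (Rtop - Rbot)) with hq
  have hq0 : 0 ≤ q := div_nonneg hlD hm.le
  have hq1 : q < 1 := (div_lt_one hm).2 (by linarith)
  have hstep : ∀ k, dist (r (k + 2)) (r (k + 3)) ≤ q * dist (r (k + 1)) (r (k + 2)) := by
    intro k
    have := bwa_rank_lip hN Rbot Rtop hbt R hR (c (k + 1)) (c (k + 2))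
      (1 - lam * (Rtop - Rbot)) (lam * dist (r (k + 1)) (r (k + 2))) hm
      (mul_nonneg hlam0 dist_nonneg) (hclow k) (hcpos _) (fun i => by
        rw [hcstep k, hcstep (k + 1)]
        exact bwa_rep_lip hM R lam hlam0 _ _ i)
    rw [← hrstep, ← hrstep] at this
    refine this.trans (le_of_eq ?_)
    rw [hq]
    ring
  have hgeo : ∀ k, dist (r (k + 1)) (r (k + 1 + 1)) ≤ dist (r 1) (r 2) * q ^ k := by
    intro k
    induction k with
    | zero => simp
    | succ k ih =>
      refine (hstep k).trans ((mul_le_mul_of_nonneg_left ih hq0).trans (le_of_eq ?_))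
      ring
  obtain ⟨x, hx⟩ := cauchySeq_tendsto_of_complete
    (cauchySeq_of_le_geometric q _ hq1 (f := fun k => r (k + 1)) hgeo)
  exact ⟨x, (tendsto_add_atTop_iff_nat 1).1 hx⟩
end
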